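/- arXiv:1804.08805 — 3 statements merged into one kernel-verified Lean document; each statement's English description precedes it below -/
import Mathlib

section
/- Let u = (u_1,…,u_N) : ℝ^d × [0,T) → ℝ^N be a classical solution of the Allen–Cahn system (AC). If Σ_{i=1}^N u_i(x,0)² = 1 for every x ∈ ℝ^d, then Σ_{i=1}^N u_i(x,t)² = 1 for every (x,t) ∈ ℝ^d × [0,T). -/
open MeasureTheory Set Filter
open scoped InnerProductSpace

noncomputable section

/-- Euclidean space `ℝ^d`. -/
abbrev Euc (d : ℕ) := EuclideanSpace ℝ (Fin d)

/-- The double-well potential `W(s) = s²(1-s)²/2`. -/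
def W (s : ℝ) : ℝ := s ^ 2 * (1 - s) ^ 2 / 2

/-- Its derivative `W'(s) = 2s³ - 3s² + s`. -/
def W' (s : ℝ) : ℝ := 2 * s ^ 3 - 3 * s ^ 2 + s

/-- Partial derivative in the `k`-th coordinate direction. -/
def pd (d : ℕ) (k : Fin d) (f : Euc d → ℝ) (x : Euc d) : ℝ :=
  fderiv ℝ f x (EuclideanSpace.single k 1)

/-- The Laplacian of `f : ℝ^d → ℝ`. -/
def lap (d : ℕ) (f : Euc d → ℝ) (x : Euc d) : ℝ :=
  ∑ k : Fin d, pd d k (fun y => pd d k f y) x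

/-- The vector in `ℝ^d` with integer coordinates `v`. -/
def intVec {d : ℕ} (v : Fin d → ℤ) : Euc d :=
  (EuclideanSpace.equiv (Fin d) ℝ).symm (fun k => (v k : ℝ))

/-- A function on `ℝ^d` is `ℤ^d`-periodic if it is invariant under translation by
every integer vector. -/
def ZPeriodic {d : ℕ} {α : Type*} (f : Euc d → α) : Prop :=
  ∀ (x : Euc d) (v : Fin d → ℤ), f (x + intVec v) = f x

/-- The fundamental domain `Q = [0,1)^d` of the torus. -/
def QCube (d : ℕ) : Set (Euc d) := {x | ∀ k, x k ∈ Ico (0:ℝ) 1}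

/-- `σ = ∫₀¹ √(2W(a)) da`. -/
def sigma0 : ℝ := ∫ a in (0:ℝ)..1, Real.sqrt (2 * W a)

/-- A classical solution of the Allen–Cahn system (AC): `ℤ^d`-periodic in `x`, twice
continuously differentiable in `x` and once in `t` (with continuous derivatives), and
satisfying `ε ∂ₜ uᵢ = ε Δuᵢ - W'(uᵢ)/ε + λᵋ uᵢ` on `ℝ^d × (0,T)`, where
`λᵋ = Σⱼ uⱼ (-ε Δuⱼ + W'(uⱼ)/ε)`. -/
structure IsACSolution (d N : ℕ) (T ε : ℝ) (u : Fin N → ℝ → Euc d → ℝ) : Prop where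
  periodic : ∀ i t, ZPeriodic (u i t)
  regx : ∀ i t, ContDiff ℝ 2 (u i t)
  regt : ∀ i x, ContDiffOn ℝ 1 (fun s => u i s x) (Ico 0 T)
  cont_u : ∀ i, ContinuousOn (fun p : ℝ × Euc d => u i p.1 p.2) (Ico 0 T ×ˢ univ)
  cont_dt : ∀ i, ContinuousOn (fun p : ℝ × Euc d => deriv (fun s => u i s p.2) p.1)
    (Ioo 0 T ×ˢ univ)
  cont_grad : ∀ i, ContinuousOn (fun p : ℝ × Euc d => gradient (u i p.1) p.2)
    (Ico 0 T ×ˢ univ)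
  cont_lap : ∀ i, ContinuousOn (fun p : ℝ × Euc d => lap d (u i p.1) p.2)
    (Ico 0 T ×ˢ univ)
  eqn : ∀ i x, ∀ t ∈ Ioo 0 T,
    ε * deriv (fun s => u i s x) t =
      ε * lap d (u i t) x - W' (u i t x) / ε +
        (∑ j, u j t x * (-(ε * lap d (u j t) x) + W' (u j t x) / ε)) * u i t x

/-- A scalar solution of the linear equation `q' = a q` with `a` bounded above and `q 0 = 0`
vanishes identically. -/
theorem eq_zero_of_hasDerivAt_mul {q a : ℝ → ℝ} {b K : ℝ} (hb : 0 ≤ b)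
    (hq : ContinuousOn q (Icc 0 b)) (hq' : ∀ t ∈ Ioo 0 b, HasDerivAt q (a t * q t) t)
    (ha : ∀ t ∈ Ioo 0 b, a t ≤ K) (h0 : q 0 = 0) : q b = 0 := by
  have hder : ∀ t ∈ Ioo 0 b, HasDerivAt (fun s => q s ^ 2 * Real.exp (-(2 * K) * s))
      (2 * (a t - K) * q t ^ 2 * Real.exp (-(2 * K) * t)) t := by
    intro t ht
    have h1 := (hq' t ht).pow 2
    have h2 := ((hasDerivAt_id t).const_mul (-(2 * K))).exp
    refine (h1.mul h2).congr_deriv ?_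
    simp
    ring
  have hanti : AntitoneOn (fun s => q s ^ 2 * Real.exp (-(2 * K) * s)) (Icc 0 b) := by
    refine antitoneOn_of_deriv_nonpos (convex_Icc 0 b) (by fun_prop) ?_ ?_
    · rw [interior_Icc]
      exact fun t ht => (hder t ht).differentiableAt.differentiableWithinAt
    · rw [interior_Icc]
      intro t ht
      rw [(hder t ht).deriv]
      have h1 : 2 * (a t - K) ≤ 0 := by linarith [ha t ht]
      exact mul_nonpos_of_nonpos_of_nonneg
        (mul_nonpos_of_nonpos_of_nonneg h1 (sq_nonneg _)) (Real.exp_pos _).le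
  have h := hanti (left_mem_Icc.2 hb) (right_mem_Icc.2 hb) hb
  simp only [h0, zero_pow two_ne_zero, zero_mul] at h
  have h2 : q b ^ 2 ≤ 0 := nonpos_of_mul_nonpos_left h (Real.exp_pos _)
  exact pow_eq_zero_iff two_ne_zero |>.1 (le_antisymm h2 (sq_nonneg _))

/-- Along a classical solution of (AC), `q = Σᵢ uᵢ² - 1` solves `∂ₜ q = (2 λᵋ / ε) q`. -/
theorem IsACSolution.hasDerivAt_sum_sq_sub_one {d N : ℕ} {T ε : ℝ}
    {u : Fin N → ℝ → Euc d → ℝ} (hu : IsACSolution d N T ε u) (hε : 0 < ε) (x : Euc d)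
    {t : ℝ} (ht : t ∈ Ioo 0 T) :
    HasDerivAt (fun s => ∑ i, u i s x ^ 2 - 1)
      (2 / ε * (∑ j, u j t x * (-(ε * lap d (u j t) x) + W' (u j t x) / ε)) *
        (∑ i, u i t x ^ 2 - 1)) t := by
  set l := ∑ j, u j t x * (-(ε * lap d (u j t) x) + W' (u j t x) / ε) with hl
  have hd : ∀ i, HasDerivAt (fun s => u i s x) (deriv (fun s => u i s x) t) t := fun i =>
    (((hu.regt i x).differentiableOn one_ne_zero t (Ioo_subset_Ico_self ht)).differentiableAt
      (Ico_mem_nhds ht.1 ht.2)).hasDerivAt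
  have hsum : HasDerivAt (fun s => ∑ i, u i s x ^ 2 - 1)
      (∑ i, 2 * u i t x * deriv (fun s => u i s x) t) t := by
    refine (HasDerivAt.fun_sum fun i _ => ?_).sub_const 1
    simpa using (hd i).fun_pow 2
  refine hsum.congr_deriv ?_
  have key : ∀ i, 2 * u i t x * deriv (fun s => u i s x) t =
      2 / ε * (l * u i t x ^ 2 - u i t x * (-(ε * lap d (u i t) x) + W' (u i t x) / ε)) := by
    intro i
    have h := hu.eqn i x t ht
    rw [← hl] at h
    have h' : deriv (fun s => u i s x) t =
        1 / ε * (ε * lap d (u i t) x - W' (u i t x) / ε + l * u i t x) := by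
      rw [← h]
      field_simp
    rw [h']
    ring
  rw [Finset.sum_congr rfl fun i _ => key i, ← Finset.mul_sum, Finset.sum_sub_distrib,
    ← Finset.mul_sum, ← hl]
  ring

theorem continuousOn_slice_left {X Y : Type*} [TopologicalSpace X] [TopologicalSpace Y]
    {F : ℝ → X → Y} {s : Set ℝ}
    (hF : ContinuousOn (fun p : ℝ × X => F p.1 p.2) (s ×ˢ univ)) (x : X) :
    ContinuousOn (fun t => F t x) s :=
  hF.comp (f := fun t : ℝ => (t, x)) (by fun_prop) fun _ ht => ⟨ht, mem_univ _⟩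

/-- A classical solution of the Allen–Cahn system (AC) with
`Σᵢ uᵢ(x,0)² = 1` for every `x` satisfies `Σᵢ uᵢ(x,t)² = 1` for every
`(x,t) ∈ ℝ^d × [0,T)`. -/
theorem allen_cahn_unit_sphere
    {d N : ℕ} (hd : 2 ≤ d) (hN : 2 ≤ N) {T ε : ℝ} (hT : 0 < T) (hε : ε ∈ Ioo (0:ℝ) 1)
    (u : Fin N → ℝ → Euc d → ℝ) (hu : IsACSolution d N T ε u)
    (hinit : ∀ x, ∑ i, (u i 0 x) ^ 2 = 1) :
    ∀ x, ∀ t ∈ Ico 0 T, ∑ i, (u i t x) ^ 2 = 1 := by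
  intro x t ht
  have hε0 : 0 < ε := hε.1
  have hsub : Icc 0 t ⊆ Ico 0 T := fun s hs => ⟨hs.1, hs.2.trans_lt ht.2⟩
  have hcu : ∀ i, ContinuousOn (fun s => u i s x) (Icc 0 t) := fun i =>
    (continuousOn_slice_left (F := fun s y => u i s y) (hu.cont_u i) x).mono hsub
  have hcl : ∀ i, ContinuousOn (fun s => lap d (u i s) x) (Icc 0 t) := fun i =>
    (continuousOn_slice_left (F := fun s y => lap d (u i s) y) (hu.cont_lap i) x).mono hsub
  have hca : ContinuousOn (fun s => 2 / ε *
      ∑ j, u j s x * (-(ε * lap d (u j s) x) + W' (u j s x) / ε)) (Icc 0 t) := by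
    have hW : Continuous W' := by
      unfold W'
      fun_prop
    refine continuousOn_const.mul (continuousOn_finsetSum _ fun j _ => (hcu j).mul ?_)
    exact (continuousOn_const.mul (hcl j)).neg.add
      ((hW.comp_continuousOn (hcu j)).div_const ε)
  have hcq : ContinuousOn (fun s => ∑ i, u i s x ^ 2 - 1) (Icc 0 t) :=
    (continuousOn_finsetSum _ fun i _ => (hcu i).pow 2).sub continuousOn_const
  obtain ⟨K, hK⟩ := isCompact_Icc.bddAbove_image hca
  have h := eq_zero_of_hasDerivAt_mul (q := fun s => ∑ i, u i s x ^ 2 - 1) ht.1 hcq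
    (fun s hs => hu.hasDerivAt_sum_sq_sub_one hε0 x ⟨hs.1, hs.2.trans ht.2⟩)
    (fun s hs => hK (mem_image_of_mem _ (Ioo_subset_Icc_self hs))) (sub_eq_zero.2 (hinit x))
  exact sub_eq_zero.1 h
end
end

section
/- Let w = (w_1,…,w_N) : ℝ^d × [0,T) → ℝ^N be ℤ^d-periodic in x, twice continuously differentiable in x and once in t, with Σ_{i=1}^N 2W(w_i(x,t)) > 0 everywhere, and satisfy ε ∂_t w_i = ε Δ w_i − W'(w_i)/ε + Λ₂ᵋ √(2W(w_i)) on ℝ^d × (0,T) for each i, where Λ₂ᵋ = (Σ_{j=1}^N √(2W(w_j)) (−ε Δ w_j + W'(w_j)/ε)) / (Σ_{j=1}^N 2W(w_j)). Then ∂_t (Σ_{i=1}^N k(w_i))(x,t) = 0 for all (x,t) ∈ ℝ^d × (0,T), where k(s) = ∫₀^s √(2W(a)) da; in particular, if Σ_{i=1}^N k(w_i(x,0)) = 1/6 for every x, then Σ_{i=1}^N k(w_i(x,t)) = 1/6 for every (x,t) ∈ ℝ^d × [0,T). -/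
open MeasureTheory Set Filter
open scoped InnerProductSpace

noncomputable section

/-- `k(s) = ∫₀^s √(2W(a)) da`. -/
def kIntegral (s : ℝ) : ℝ := ∫ a in (0:ℝ)..s, Real.sqrt (2 * W a)

lemma W_nonneg (s : ℝ) : 0 ≤ W s := by
  unfold W
  positivity

lemma hasDerivAt_kIntegral (s : ℝ) : HasDerivAt kIntegral (Real.sqrt (2 * W s)) s := by
  have hc : Continuous fun a => Real.sqrt (2 * W a) := by
    unfold W
    fun_prop
  exact intervalIntegral.integral_hasDerivAt_right (hc.intervalIntegrable _ _)
    (hc.stronglyMeasurableAtFilter _ _) hc.continuousAt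

lemma continuous_kIntegral : Continuous kIntegral :=
  continuous_iff_continuousAt.2 fun s => (hasDerivAt_kIntegral s).continuousAt

/-- Adding the multiplier `-⟨g, a⟩ / ⟨g, g⟩` times `g` to a vector `a` makes it orthogonal to `g`. -/
lemma sum_mul_add_multiplier_eq_zero {ι : Type*} [Fintype ι] (g a : ι → ℝ)
    (hg : ∑ j, g j ^ 2 ≠ 0) :
    ∑ i, g i * (a i + (∑ j, g j * -a j) / (∑ j, g j ^ 2) * g i) = 0 := by
  have h : ∀ i, g i * (a i + (∑ j, g j * -a j) / (∑ j, g j ^ 2) * g i) =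
      g i * a i + (∑ j, g j * -a j) / (∑ j, g j ^ 2) * g i ^ 2 := fun i => by ring
  simp only [h, Finset.sum_add_distrib, ← Finset.mul_sum]
  rw [div_mul_cancel₀ _ hg]
  simp

/-- For a classical (periodic) solution of the Allen–Cahn system
`ε ∂ₜ wᵢ = ε Δwᵢ - W'(wᵢ)/ε + Λ₂ᵋ √(2W(wᵢ))` with
`Λ₂ᵋ = (Σⱼ √(2W(wⱼ))(-εΔwⱼ + W'(wⱼ)/ε)) / (Σⱼ 2W(wⱼ))` and `Σⱼ 2W(wⱼ) > 0` everywhere,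
the quantity `Σᵢ k(wᵢ)` is constant in time, where `k(s) = ∫₀^s √(2W(a)) da`;
in particular `Σᵢ k(wᵢ(·,0)) ≡ 1/6` implies `Σᵢ k(wᵢ(·,t)) ≡ 1/6` for all `t ∈ [0,T)`. -/
theorem k_sum_preserved_weighted_multiplier
    {d N : ℕ} (hd : 2 ≤ d) (hN : 2 ≤ N) {T ε : ℝ} (hT : 0 < T) (hε : ε ∈ Ioo (0:ℝ) 1)
    (w : Fin N → ℝ → Euc d → ℝ)
    (hper : ∀ i t, ZPeriodic (w i t))
    (hregx : ∀ i t, ContDiff ℝ 2 (w i t))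
    (hregt : ∀ i x, ContDiffOn ℝ 1 (fun s => w i s x) (Ico 0 T))
    (hpos : ∀ x t, 0 < ∑ i, 2 * W (w i t x))
    (heqn : ∀ i x, ∀ t ∈ Ioo 0 T,
      ε * deriv (fun s => w i s x) t =
        ε * lap d (w i t) x - W' (w i t x) / ε +
          ((∑ j, Real.sqrt (2 * W (w j t x)) * (-(ε * lap d (w j t) x) + W' (w j t x) / ε)) /
              (∑ j, 2 * W (w j t x))) *
            Real.sqrt (2 * W (w i t x))) :
    (∀ x, ∀ t ∈ Ioo 0 T, deriv (fun s => ∑ i, kIntegral (w i s x)) t = 0) ∧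
    ((∀ x, ∑ i, kIntegral (w i 0 x) = 1 / 6) →
      ∀ x, ∀ t ∈ Ico 0 T, ∑ i, kIntegral (w i t x) = 1 / 6) := by
  have hderiv : ∀ x, ∀ t ∈ Ioo 0 T,
      HasDerivAt (fun s => ∑ i, kIntegral (w i s x)) 0 t := by
    intro x t ht
    have hw : ∀ i, HasDerivAt (fun s => w i s x) (deriv (fun s => w i s x) t) t := fun i =>
      (((hregt i x).contDiffAt (Ico_mem_nhds ht.1 ht.2)).differentiableAt
        one_ne_zero).hasDerivAt
    have hsum : HasDerivAt (fun s => ∑ i, kIntegral (w i s x))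
        (∑ i, Real.sqrt (2 * W (w i t x)) * deriv (fun s => w i s x) t) t :=
      HasDerivAt.fun_sum fun i _ => (hasDerivAt_kIntegral (w i t x)).comp (h₂ := kIntegral) t (hw i)
    have hsq : ∀ i, Real.sqrt (2 * W (w i t x)) ^ 2 = 2 * W (w i t x) := fun i =>
      Real.sq_sqrt (mul_nonneg zero_le_two (W_nonneg _))
    have hz := sum_mul_add_multiplier_eq_zero (fun i => Real.sqrt (2 * W (w i t x)))
      (fun i => ε * lap d (w i t) x - W' (w i t x) / ε)
      (by simpa only [hsq] using (hpos x t).ne')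
    simp only [hsq, neg_sub'] at hz
    have hε0 : ε * (∑ i, Real.sqrt (2 * W (w i t x)) * deriv (fun s => w i s x) t) = 0 := by
      rw [Finset.mul_sum, ← hz]
      refine Finset.sum_congr rfl fun i _ => ?_
      rw [mul_left_comm, heqn i x t ht]
      simp only [sub_neg_eq_add]
    rwa [(mul_eq_zero.1 hε0).resolve_left hε.1.ne'] at hsum
  refine ⟨fun x t ht => (hderiv x t ht).deriv, fun h0 x t ht => ?_⟩
  rcases ht.1.eq_or_lt with rfl | ht0
  · exact h0 x
  have hcont : ContinuousOn (fun s => ∑ i, kIntegral (w i s x)) (Icc 0 t) :=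
    continuousOn_finsetSum _ fun i _ => continuous_kIntegral.comp_continuousOn
      ((hregt i x).continuousOn.mono (Icc_subset_Ico_right ht.2))
  obtain ⟨c, -, hc⟩ := exists_hasDerivAt_eq_slope _ (fun _ => 0) ht0 hcont
    fun s hs => hderiv x s ⟨hs.1, hs.2.trans ht.2⟩
  rw [eq_comm, div_eq_zero_iff, or_iff_left (sub_pos.2 ht0).ne', sub_eq_zero] at hc
  exact hc.trans (h0 x)
end
end

section
/- Let u : ℝ^d → ℝ be a ℤ^d-periodic C² function and g : ℝ^d → ℝ^d a ℤ^d-periodic C¹ vector field. Writing n(x) = ∇u(x)/|∇u(x)| on the set {∇u ≠ 0}, and denoting by A : B = Σ_{k,l} A_{kl} B_{kl} the Frobenius pairing of d×d matrices, the following integration-by-parts identity holds: ∫_{Q ∩ {∇u ≠ 0}} (I − n ⊗ n) : ∇g · (ε|∇u|²/2 + W(u)/ε) dx = − ∫_Q (g · ∇u)(−ε Δ u + W'(u)/ε) dx + ∫_{Q ∩ {∇u ≠ 0}} (n ⊗ n) : ∇g · (ε|∇u|²/2 − W(u)/ε) dx − ∫_{Q ∩ {∇u = 0}} (div g) · W(u)/ε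 dx. -/
open MeasureTheory Set Filter
open scoped InnerProductSpace

noncomputable section

/-- The unit normal `n = ∇u/|∇u|` (as a coordinate vector). -/
def nvec {d : ℕ} (u : Euc d → ℝ) (x : Euc d) (k : Fin d) : ℝ :=
  gradient u x k / ‖gradient u x‖

/-- The Jacobian matrix `(∇g)_{kl} = ∂_{x_l} g_k` of a vector field `g`. -/
def jac {d : ℕ} (g : Euc d → Euc d) (x : Euc d) (k l : Fin d) : ℝ :=
  pd d l (fun y => g y k) x

section PartialDerivatives

variable {d : ℕ} {f h : Euc d → ℝ} {x : Euc d}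

theorem pd_add (k : Fin d) (hf : DifferentiableAt ℝ f x) (hh : DifferentiableAt ℝ h x) :
    pd d k (fun y => f y + h y) x = pd d k f x + pd d k h x := by
  simp [pd, fderiv_fun_add hf hh]

theorem pd_sub (k : Fin d) (hf : DifferentiableAt ℝ f x) (hh : DifferentiableAt ℝ h x) :
    pd d k (fun y => f y - h y) x = pd d k f x - pd d k h x := by
  simp [pd, fderiv_fun_sub hf hh]

theorem pd_mul (k : Fin d) (hf : DifferentiableAt ℝ f x) (hh : DifferentiableAt ℝ h x) :
    pd d k (fun y => f y * h y) x = f x * pd d k h x + h x * pd d k f x := by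
  simp [pd, fderiv_fun_mul hf hh]

theorem pd_const_mul (k : Fin d) (c : ℝ) (hf : DifferentiableAt ℝ f x) :
    pd d k (fun y => c * f y) x = c * pd d k f x := by
  rw [pd_mul k (differentiableAt_const c) hf]
  simp [pd]

theorem pd_sum (k : Fin d) {ι : Type*} (s : Finset ι) {F : ι → Euc d → ℝ}
    (hF : ∀ i ∈ s, DifferentiableAt ℝ (F i) x) :
    pd d k (fun y => ∑ i ∈ s, F i y) x = ∑ i ∈ s, pd d k (F i) x := by
  simp [pd, fderiv_fun_sum hF]

theorem hasDerivAt_W (s : ℝ) : HasDerivAt W (W' s) s := by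
  have h1 : HasDerivAt (fun s : ℝ => s ^ 2 * (1 - s) ^ 2 / 2) _ s :=
    (((hasDerivAt_id s).pow 2).mul
      (((hasDerivAt_const s (1 : ℝ)).sub (hasDerivAt_id s)).pow 2)).div_const 2
  refine h1.congr_deriv ?_
  simp [W']
  ring

theorem contDiff_W {n : WithTop ℕ∞} : ContDiff ℝ n W := by
  unfold W
  fun_prop

theorem continuous_W' : Continuous W' := by
  unfold W'
  fun_prop

theorem pd_W_comp (k : Fin d) (hf : DifferentiableAt ℝ f x) :
    pd d k (fun y => W (f y)) x = W' (f x) * pd d k f x := by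
  have := ((hasDerivAt_W (f x)).comp_hasFDerivAt x hf.hasFDerivAt).fderiv
  simp only [pd]
  change fderiv ℝ (W ∘ f) x _ = _
  rw [this]
  simp

theorem ContDiff.pd {m n : WithTop ℕ∞} (hf : ContDiff ℝ n f) (hmn : m + 1 ≤ n) (k : Fin d) :
    ContDiff ℝ m (pd d k f) :=
  (hf.fderiv_right hmn).clm_apply contDiff_const

theorem pd_pd_comm (hf : ContDiff ℝ 2 f) (k l : Fin d) (x : Euc d) :
    pd d k (pd d l f) x = pd d l (pd d k f) x := by
  have hdiff : DifferentiableAt ℝ (fderiv ℝ f) x :=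
    ((hf.fderiv_right (m := 1) (by norm_num)).differentiable (by norm_num)) x
  have key : ∀ i j : Fin d, pd d i (pd d j f) x =
      fderiv ℝ (fderiv ℝ f) x (EuclideanSpace.single i 1) (EuclideanSpace.single j 1) := by
    intro i j
    change fderiv ℝ (fun y => fderiv ℝ f y (EuclideanSpace.single j 1)) x _ = _
    rw [fderiv_clm_apply hdiff (differentiableAt_const _)]
    simp
  rw [key, key]
  exact (hf.contDiffAt.isSymmSndFDerivAt (by simp)) _ _

theorem ZPeriodic.pd (hf : ZPeriodic f) (k : Fin d) : ZPeriodic (pd d k f) := by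
  intro x v
  have : (fun y => f (y + intVec v)) = f := funext fun y => hf y v
  simp only [_root_.pd]
  rw [← fderiv_comp_add_right, this]

theorem gradient_apply (f : Euc d → ℝ) (x : Euc d) (k : Fin d) :
    gradient f x k = pd d k f x := by
  have h1 : (InnerProductSpace.toDual ℝ (Euc d)) (gradient f x) (EuclideanSpace.single k 1)
      = pd d k f x := by
    rw [toDual_gradient]; rfl
  rw [InnerProductSpace.toDual_apply_apply] at h1
  rwa [EuclideanSpace.inner_single_right, one_mul, conj_trivial] at h1

theorem norm_gradient_sq (f : Euc d → ℝ) (x : Euc d) :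
    ‖gradient f x‖ ^ 2 = ∑ k, pd d k f x ^ 2 := by
  simp [EuclideanSpace.norm_sq_eq, gradient_apply]

theorem inner_gradient_eq_sum (v : Euc d) (f : Euc d → ℝ) (x : Euc d) :
    ⟪v, gradient f x⟫_ℝ = ∑ k, v k * pd d k f x := by
  rw [PiLp.inner_apply]
  refine Finset.sum_congr rfl fun k _ => ?_
  rw [gradient_apply]
  exact mul_comm _ _

theorem ContDiff.continuous_gradient (hf : ContDiff ℝ 1 f) : Continuous (gradient f) :=
  (InnerProductSpace.toDual ℝ (Euc d)).symm.continuous.comp (hf.continuous_fderiv (by norm_num))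

end PartialDerivatives

section Cube

variable {d : ℕ}

theorem QCube_eq_preimage :
    QCube d = WithLp.ofLp ⁻¹' (Set.pi univ fun _ : Fin d => Ico (0 : ℝ) 1) := by
  ext x
  simp [QCube]

theorem measurableSet_QCube : MeasurableSet (QCube d) := by
  rw [QCube_eq_preimage]
  exact (PiLp.volume_preserving_ofLp (Fin d)).measurable
    (MeasurableSet.univ_pi fun _ => measurableSet_Ico)

theorem setIntegral_QCube (f : Euc d → ℝ) :
    ∫ x in QCube d, f x = ∫ y in Icc (0 : Fin d → ℝ) 1, f (WithLp.toLp 2 y) := by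
  have h := (PiLp.volume_preserving_ofLp (Fin d)).setIntegral_preimage_emb
    (MeasurableEquiv.toLp 2 (Fin d → ℝ)).symm.measurableEmbedding
    (fun y => f (WithLp.toLp 2 y)) (Set.pi univ fun _ : Fin d => Ico (0 : ℝ) 1)
  rw [← QCube_eq_preimage] at h
  refine h.trans (setIntegral_congr_set ?_)
  exact Measure.univ_pi_Ico_ae_eq_Icc (f := (0 : Fin d → ℝ)) (g := 1)

theorem Continuous.integrableOn_QCube {f : Euc d → ℝ} (hf : Continuous f) :
    IntegrableOn f (QCube d) := by
  have hK : IsCompact (WithLp.toLp 2 '' Icc (0 : Fin d → ℝ) 1 : Set (Euc d)) :=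
    isCompact_Icc.image (PiLp.continuous_toLp 2 _)
  refine (hf.continuousOn.integrableOn_compact hK).mono_set fun x hx => ?_
  exact ⟨WithLp.ofLp x, ⟨fun k => (hx k).1, fun k => (hx k).2.le⟩, rfl⟩

/-- The divergence theorem on the torus. -/
theorem integral_QCube_sum_pd_eq_zero (F : Fin d → Euc d → ℝ)
    (hF : ∀ l, ContDiff ℝ 1 (F l)) (hFp : ∀ l, ZPeriodic (F l)) :
    ∫ x in QCube d, ∑ l, pd d l (F l) x = 0 := by
  cases d with
  | zero => simp
  | succ n =>
    rw [setIntegral_QCube]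
    set e : (Fin (n + 1) → ℝ) →L[ℝ] Euc (n + 1) :=
      ((EuclideanSpace.equiv (Fin (n + 1)) ℝ).symm : (Fin (n + 1) → ℝ) →L[ℝ] Euc (n + 1))
    have hcont : Continuous fun y : Fin (n + 1) → ℝ =>
        ∑ l, pd (n + 1) l (F l) (WithLp.toLp 2 y) :=
      continuous_finsetSum _ fun l _ =>
        (((hF l).pd (m := 0) (by norm_num) l).continuous).comp (PiLp.continuous_toLp 2 _)
    have h := integral_divergence_of_hasFDerivAt_off_countable'
      (0 : Fin (n + 1) → ℝ) 1 zero_le_one (fun l y => F l (WithLp.toLp 2 y))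
      (fun l y => (fderiv ℝ (F l) (WithLp.toLp 2 y)).comp e) ∅ countable_empty
      (fun l => ((hF l).continuous.comp (PiLp.continuous_toLp 2 _)).continuousOn)
      (fun y _ l => (((hF l).differentiable (by norm_num)) _).hasFDerivAt.comp y e.hasFDerivAt)
      hcont.continuousOn.integrableOn_Icc
    refine h.trans (Finset.sum_eq_zero fun l _ => ?_)
    rw [sub_eq_zero]
    refine integral_congr_ae (Eventually.of_forall fun y => ?_)
    have := hFp l (WithLp.toLp 2 (l.insertNth (0 : ℝ) y)) (Pi.single l 1)
    simp only [Pi.zero_apply, Pi.one_apply]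
    rw [← this]
    congr 1
    ext k
    rcases Fin.eq_self_or_eq_succAbove l k with rfl | ⟨j, rfl⟩
    · simp [intVec]
    · simp [intVec, Fin.succAbove_ne]

end Cube

section FirstVariation

variable {d : ℕ} {u : Euc d → ℝ} {g : Euc d → Euc d}

theorem abs_nvec_le_one (u : Euc d → ℝ) (x : Euc d) (k : Fin d) : |nvec u x k| ≤ 1 := by
  rw [nvec, abs_div, abs_norm]
  exact div_le_one_of_le₀ (PiLp.norm_apply_le (gradient u x) k) (norm_nonneg _)

theorem nvec_mul_norm_gradient (u : Euc d → ℝ) (x : Euc d) (k : Fin d) :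
    nvec u x k * ‖gradient u x‖ = pd d k u x := by
  rw [← gradient_apply, nvec]
  rcases eq_or_ne (gradient u x) 0 with h | h
  · simp [h]
  · exact div_mul_cancel₀ _ (norm_ne_zero_iff.2 h)

theorem measurable_nvec (hu : ContDiff ℝ 1 u) (k : Fin d) : Measurable fun x => nvec u x k := by
  have h1 : Continuous fun x => gradient u x k :=
    (EuclideanSpace.proj (𝕜 := ℝ) k).continuous.comp hu.continuous_gradient
  exact h1.measurable.div hu.continuous_gradient.norm.measurable

theorem ContDiff.coord {n : WithTop ℕ∞} (hg : ContDiff ℝ n g) (k : Fin d) :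
    ContDiff ℝ n fun x => g x k :=
  (EuclideanSpace.proj (𝕜 := ℝ) k).contDiff.comp hg

theorem continuous_jac (hg : ContDiff ℝ 1 g) (k l : Fin d) : Continuous fun x => jac g x k l :=
  ((hg.coord k).pd (m := 0) (by norm_num) l).continuous

theorem integrableOn_nvec_nvec_jac_mul (hu : ContDiff ℝ 1 u) (hg : ContDiff ℝ 1 g)
    {c : Euc d → ℝ} (hc : Continuous c) :
    IntegrableOn (fun x => (∑ k, ∑ l, nvec u x k * nvec u x l * jac g x k l) * c x)
      (QCube d) := by
  simp only [Finset.sum_mul]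
  refine integrable_finsetSum _ fun k _ => integrable_finsetSum _ fun l _ => ?_
  simp only [mul_assoc (nvec u _ k * nvec u _ l)]
  refine Integrable.bdd_mul (c := 1)
    ((continuous_jac hg k l).mul hc).integrableOn_QCube
    ((measurable_nvec hu k).mul (measurable_nvec hu l)).aestronglyMeasurable
    (Eventually.of_forall fun x => ?_)
  rw [Real.norm_eq_abs, abs_mul]
  exact mul_le_one₀ (abs_nvec_le_one u x k) (abs_nonneg _) (abs_nvec_le_one u x l)

/-- The energy density `ε|∇u|²/2 + W(u)/ε` in coordinates. -/
def energyDensity (ε : ℝ) (u : Euc d → ℝ) (x : Euc d) : ℝ :=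
  ε / 2 * (∑ k, pd d k u x * pd d k u x) + ε⁻¹ * W (u x)

/-- The stress-energy tensor `(ε|∇u|²/2 + W(u)/ε) I - ε ∇u ⊗ ∇u` applied to `g`. -/
def stressEnergy (ε : ℝ) (u : Euc d → ℝ) (g : Euc d → Euc d) (l : Fin d) (x : Euc d) : ℝ :=
  g x l * energyDensity ε u x - ε * (pd d l u x * ∑ k, g x k * pd d k u x)

theorem contDiff_energyDensity (ε : ℝ) (hu : ContDiff ℝ 2 u) :
    ContDiff ℝ 1 (energyDensity ε u) := by
  have h1 : ∀ k, ContDiff ℝ 1 (pd d k u) := fun k => hu.pd (by norm_num) k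
  exact (contDiff_const.mul (ContDiff.sum fun k _ => (h1 k).mul (h1 k))).add
    (contDiff_const.mul (contDiff_W.comp (hu.of_le (by norm_num))))

theorem contDiff_stressEnergy (ε : ℝ) (hu : ContDiff ℝ 2 u) (hg : ContDiff ℝ 1 g) (l : Fin d) :
    ContDiff ℝ 1 (stressEnergy ε u g l) := by
  have h1 : ∀ k, ContDiff ℝ 1 (pd d k u) := fun k => hu.pd (by norm_num) k
  exact ((hg.coord l).mul (contDiff_energyDensity ε hu)).sub
    (contDiff_const.mul ((h1 l).mul (ContDiff.sum fun k _ => (hg.coord k).mul (h1 k))))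

theorem zPeriodic_stressEnergy (ε : ℝ) (hup : ZPeriodic u) (hgp : ZPeriodic g) (l : Fin d) :
    ZPeriodic (stressEnergy ε u g l) := by
  intro x v
  have h1 : ∀ k, pd d k u (x + intVec v) = pd d k u x := fun k => hup.pd k x v
  simp only [stressEnergy, energyDensity, h1, hup x v, hgp x v]

theorem pd_energyDensity (ε : ℝ) (hu : ContDiff ℝ 2 u) (l : Fin d) (x : Euc d) :
    pd d l (energyDensity ε u) x =
      ε * (∑ k, pd d k u x * pd d l (pd d k u) x) + ε⁻¹ * (W' (u x) * pd d l u x) := by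
  have h1 : ∀ k, DifferentiableAt ℝ (pd d k u) x := fun k =>
    ((hu.pd (m := 1) (by norm_num) k).differentiable (by norm_num)) x
  have hux : DifferentiableAt ℝ u x := (hu.differentiable (by norm_num)) x
  have hWx : DifferentiableAt ℝ (fun y => W (u y)) x :=
    ((contDiff_W.comp hu).differentiable (by norm_num)) x
  have h2 : ∀ k ∈ Finset.univ, DifferentiableAt ℝ (fun y => pd d k u y * pd d k u y) x :=
    fun k _ => (h1 k).mul (h1 k)
  have h3 : DifferentiableAt ℝ (fun y => ∑ k, pd d k u y * pd d k u y) x :=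
    DifferentiableAt.fun_sum h2
  unfold energyDensity
  rw [pd_add l (h3.const_mul _) (hWx.const_mul _), pd_const_mul l _ h3, pd_const_mul l _ hWx,
    pd_sum l _ h2, pd_W_comp l hux]
  simp only [pd_mul l (h1 _) (h1 _), Finset.mul_sum]
  congr 1
  exact Finset.sum_congr rfl fun k _ => by ring

theorem sum_pd_stressEnergy (ε : ℝ) (hu : ContDiff ℝ 2 u) (hg : ContDiff ℝ 1 g) (x : Euc d) :
    ∑ l, pd d l (stressEnergy ε u g l) x =
      (∑ k, jac g x k k) * energyDensity ε u x
      + (∑ k, g x k * pd d k u x) * (-(ε * lap d u x) + W' (u x) / ε)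
      - ε * ∑ k, ∑ l, pd d k u x * pd d l u x * jac g x k l := by
  have h1 : ∀ k, DifferentiableAt ℝ (pd d k u) x := fun k =>
    ((hu.pd (m := 1) (by norm_num) k).differentiable (by norm_num)) x
  have h2 : ∀ k, DifferentiableAt ℝ (fun y => g y k) x := fun k =>
    ((hg.coord k).differentiable (by norm_num)) x
  have h3 : ∀ k ∈ Finset.univ, DifferentiableAt ℝ (fun y => g y k * pd d k u y) x :=
    fun k _ => (h2 k).mul (h1 k)
  have h4 : DifferentiableAt ℝ (fun y => ∑ k, g y k * pd d k u y) x :=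
    DifferentiableAt.fun_sum h3
  have h5 : DifferentiableAt ℝ (energyDensity ε u) x :=
    ((contDiff_energyDensity ε hu).differentiable (by norm_num)) x
  have hterm : ∀ l, pd d l (stressEnergy ε u g l) x =
      jac g x l l * energyDensity ε u x
      + ε * (∑ k, g x l * (pd d k u x * pd d k (pd d l u) x))
      + (g x l * pd d l u x) * (W' (u x) / ε)
      - ε * (∑ k, g x k * pd d k u x) * pd d l (pd d l u) x
      - ε * (∑ k, g x k * (pd d l u x * pd d l (pd d k u) x))
      - ε * ∑ k, pd d k u x * pd d l u x * jac g x k l := by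
    intro l
    have h6 : DifferentiableAt ℝ (fun y => g y l * energyDensity ε u y) x := (h2 l).mul h5
    have h7 : DifferentiableAt ℝ (fun y => pd d l u y * ∑ k, g y k * pd d k u y) x :=
      (h1 l).mul h4
    unfold stressEnergy
    rw [pd_sub l h6 (h7.const_mul _), pd_mul l (h2 l) h5,
      pd_const_mul l _ h7, pd_mul l (h1 l) h4, pd_sum l _ h3,
      pd_energyDensity ε hu]
    have hmix : ∑ k, pd d l (fun y => g y k * pd d k u y) x =
        ∑ k, g x k * pd d l (pd d k u) x + ∑ k, pd d k u x * jac g x k l := by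
      rw [← Finset.sum_add_distrib]
      exact Finset.sum_congr rfl fun k _ => pd_mul l (h2 k) (h1 k)
    have e1 : ∑ k, g x l * (pd d k u x * pd d k (pd d l u) x) =
        g x l * ∑ k, pd d k u x * pd d l (pd d k u) x := by
      rw [Finset.mul_sum]
      exact Finset.sum_congr rfl fun k _ => by rw [pd_pd_comm hu k l]
    have e2 : ∑ k, g x k * (pd d l u x * pd d l (pd d k u) x) =
        pd d l u x * ∑ k, g x k * pd d l (pd d k u) x := by
      rw [Finset.mul_sum]
      exact Finset.sum_congr rfl fun k _ => by ring
    have e3 : ∑ k, pd d k u x * pd d l u x * jac g x k l =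
        pd d l u x * ∑ k, pd d k u x * jac g x k l := by
      rw [Finset.mul_sum]
      exact Finset.sum_congr rfl fun k _ => by ring
    rw [hmix, e1, e2, e3]
    change _ + energyDensity ε u x * jac g x l l - _ = _
    ring
  simp only [hterm, Finset.sum_sub_distrib, Finset.sum_add_distrib, ← Finset.mul_sum,
    ← Finset.sum_mul]
  rw [Finset.sum_comm (f := fun l k => g x k * (pd d l u x * pd d l (pd d k u) x)),
    Finset.sum_comm (f := fun l k => pd d k u x * pd d l u x * jac g x k l)]
  simp only [lap, Finset.mul_sum]
  simp only [← Finset.mul_sum]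
  ring

end FirstVariation

/-- Integration by parts identity for the first variation:
`∫_{Q ∩ {∇u ≠ 0}} (I - n⊗n) : ∇g (ε|∇u|²/2 + W(u)/ε) dx
 = -∫_Q (g·∇u)(-εΔu + W'(u)/ε) dx
   + ∫_{Q ∩ {∇u ≠ 0}} (n⊗n) : ∇g (ε|∇u|²/2 - W(u)/ε) dx
   - ∫_{Q ∩ {∇u = 0}} (div g) W(u)/ε dx`. -/
theorem first_variation_integration_by_parts
    {d : ℕ} (hd : 2 ≤ d) {ε : ℝ} (hε : ε ∈ Ioo (0:ℝ) 1)
    (u : Euc d → ℝ) (hu : ContDiff ℝ 2 u) (hup : ZPeriodic u)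
    (g : Euc d → Euc d) (hg : ContDiff ℝ 1 g) (hgp : ZPeriodic g) :
    (∫ x in QCube d ∩ {x | gradient u x ≠ 0},
        (∑ k, ∑ l, ((if k = l then (1:ℝ) else 0) - nvec u x k * nvec u x l) * jac g x k l) *
          (ε * ‖gradient u x‖ ^ 2 / 2 + W (u x) / ε)) =
      -(∫ x in QCube d, ⟪g x, gradient u x⟫_ℝ * (-(ε * lap d u x) + W' (u x) / ε))
      + (∫ x in QCube d ∩ {x | gradient u x ≠ 0},
          (∑ k, ∑ l, nvec u x k * nvec u x l * jac g x k l) *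
            (ε * ‖gradient u x‖ ^ 2 / 2 - W (u x) / ε))
      - ∫ x in QCube d ∩ {x | gradient u x = 0},
          (∑ k, jac g x k k) * (W (u x) / ε) := by
  have hu1 : ContDiff ℝ 1 u := hu.of_le (by norm_num)
  set N : Set (Euc d) := {x | gradient u x ≠ 0} with hN
  have hNm : MeasurableSet N :=
    (isOpen_compl_singleton.preimage hu1.continuous_gradient).measurableSet
  have hNc : {x | gradient u x = 0} = Nᶜ := by ext x; simp [hN]
  have hgrad : Continuous fun x => ε * ‖gradient u x‖ ^ 2 / 2 := by
    have := hu1.continuous_gradient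
    fun_prop
  have hWu : Continuous fun x => W (u x) / ε :=
    ((contDiff_W (n := 0)).continuous.comp hu.continuous).div_const ε
  have hdiv : Continuous fun x => ∑ k, jac g x k k :=
    continuous_finsetSum _ fun k _ => continuous_jac hg k k
  have hlap : Continuous (lap d u) := continuous_finsetSum _ fun k _ =>
    ((hu.pd (m := 1) (by norm_num) k).pd (m := 0) (by norm_num) k).continuous
  have hW'u : Continuous fun x => W' (u x) / ε :=
    (continuous_W'.comp hu.continuous).div_const ε
  have htrace : ∀ x, ∑ k, ∑ l, ((if k = l then (1:ℝ) else 0) - nvec u x k * nvec u x l)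
      * jac g x k l = ∑ k, jac g x k k - ∑ k, ∑ l, nvec u x k * nvec u x l * jac g x k l := by
    intro x
    simp [sub_mul, Finset.sum_sub_distrib]
  simp only [htrace]
  rw [hNc, ← setIntegral_indicator hNm, ← setIntegral_indicator hNm,
    ← setIntegral_indicator hNm.compl]
  have iA : IntegrableOn (N.indicator fun x => (∑ k, jac g x k k -
      ∑ k, ∑ l, nvec u x k * nvec u x l * jac g x k l) *
        (ε * ‖gradient u x‖ ^ 2 / 2 + W (u x) / ε)) (QCube d) := by
    refine Integrable.indicator ?_ hNm
    simp only [sub_mul]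
    exact (hdiv.mul (hgrad.add hWu)).integrableOn_QCube.sub
      (integrableOn_nvec_nvec_jac_mul hu1 hg (hgrad.add hWu))
  have iB : IntegrableOn (N.indicator fun x =>
      (∑ k, ∑ l, nvec u x k * nvec u x l * jac g x k l) *
        (ε * ‖gradient u x‖ ^ 2 / 2 - W (u x) / ε)) (QCube d) :=
    Integrable.indicator (integrableOn_nvec_nvec_jac_mul hu1 hg (hgrad.sub hWu)) hNm
  have iC : IntegrableOn (Nᶜ.indicator fun x => (∑ k, jac g x k k) * (W (u x) / ε)) (QCube d) :=
    Integrable.indicator (hdiv.mul hWu).integrableOn_QCube hNm.compl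
  have iH : IntegrableOn (fun x => ⟪g x, gradient u x⟫_ℝ *
      (-(ε * lap d u x) + W' (u x) / ε)) (QCube d) :=
    ((hg.continuous.inner hu1.continuous_gradient).mul
      ((continuous_const.mul hlap).neg.add hW'u)).integrableOn_QCube
  have hzero := integral_QCube_sum_pd_eq_zero (stressEnergy ε u g)
    (contDiff_stressEnergy ε hu hg) (zPeriodic_stressEnergy ε hup hgp)
  have hpoint : ∀ x, ∑ l, pd d l (stressEnergy ε u g l) x =
      N.indicator (fun x => (∑ k, jac g x k k -
        ∑ k, ∑ l, nvec u x k * nvec u x l * jac g x k l) *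
          (ε * ‖gradient u x‖ ^ 2 / 2 + W (u x) / ε)) x
      + ⟪g x, gradient u x⟫_ℝ * (-(ε * lap d u x) + W' (u x) / ε)
      - N.indicator (fun x => (∑ k, ∑ l, nvec u x k * nvec u x l * jac g x k l) *
          (ε * ‖gradient u x‖ ^ 2 / 2 - W (u x) / ε)) x
      + Nᶜ.indicator (fun x => (∑ k, jac g x k k) * (W (u x) / ε)) x := by
    intro x
    have hE : energyDensity ε u x = ε * ‖gradient u x‖ ^ 2 / 2 + W (u x) / ε := by
      rw [norm_gradient_sq]
      simp only [energyDensity, pow_two]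
      ring
    have hP : ∑ k, ∑ l, pd d k u x * pd d l u x * jac g x k l =
        (∑ k, ∑ l, nvec u x k * nvec u x l * jac g x k l) * ‖gradient u x‖ ^ 2 := by
      simp only [Finset.sum_mul, ← nvec_mul_norm_gradient]
      exact Finset.sum_congr rfl fun k _ => Finset.sum_congr rfl fun l _ => by ring
    rw [sum_pd_stressEnergy ε hu hg, hE, hP, inner_gradient_eq_sum]
    by_cases hx : x ∈ N
    · rw [indicator_of_mem hx, indicator_of_mem hx, indicator_of_notMem (by simpa using hx)]
      ring
    · rw [indicator_of_notMem hx, indicator_of_notMem hx, indicator_of_mem (by simpa using hx)]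
      have h0 : gradient u x = 0 := by simpa [hN] using hx
      simp [h0]
      ring
  simp only [hpoint] at hzero
  have iAH := iA.add iH
  have iAHB := iAH.sub iB
  simp only [IntegrableOn, Pi.add_def, Pi.sub_def] at iAH iAHB
  rw [integral_add iAHB iC, integral_sub iAH iB, integral_add iA iH] at hzero
  linarith
end
end
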